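/- arXiv:2212.11446 — 3 statements merged into one kernel-verified Lean document; each statement's English description precedes it below -/
import Mathlib

section
/- Refining a belief within the best-response region of a leader-favored best response weakly increases the leader's value: fix θ : Fin K and b' ∈ Ξ, and let j* : Fin N satisfy ∑ i, b' i * F θ i j* = F̄ θ b' and ∑ i, b' i * L i j* = V̄ θ b'. If ω : (Fin M → ℝ) → ℝ is nonnegative with finite support contained in Ξ[θ,j*], total mass 1, and barycenter b', then ∑ b in supp(ω), ω b * V̄ θ b ≥ V̄ θ b'. -/
open Finset Set

attribute [local instance] Classical.propDecidable

noncomputable section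

variable {M N K : ℕ}

/-- The belief space `Ξ` is the standard simplex; the best-response region `Ξ[θ,j]` consists of
the beliefs under which `j` is a best response for the type-`θ` follower. -/
def XiBR (F : Fin K → Fin M → Fin N → ℝ) (θ : Fin K) (j : Fin N) : Set (Fin M → ℝ) :=
  {b | b ∈ stdSimplex ℝ (Fin M) ∧ ∀ j' : Fin N, ∑ i, b i * F θ i j' ≤ ∑ i, b i * F θ i j}

/-- The region `Ξ[𝐣] = ⋂ θ, Ξ[θ, 𝐣 θ]`. -/
def XiT (F : Fin K → Fin M → Fin N → ℝ) (js : Fin K → Fin N) : Set (Fin M → ℝ) :=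
  ⋂ θ : Fin K, XiBR F θ (js θ)

/-- The follower's value function `F̄ θ b = max_j ∑ i, b i * F θ i j`. -/
def Fbar (F : Fin K → Fin M → Fin N → ℝ) (θ : Fin K) (b : Fin M → ℝ) : ℝ :=
  ⨆ j : Fin N, ∑ i, b i * F θ i j

/-- The leader's (leader-favored tie-broken) value function `V̄ θ b`: the maximum of
`∑ i, b i * L i j` over the follower best responses `j` at belief `b`. -/
def Vbar (L : Fin M → Fin N → ℝ) (F : Fin K → Fin M → Fin N → ℝ) (θ : Fin K)
    (b : Fin M → ℝ) : ℝ :=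
  sSup ((fun j => ∑ i, b i * L i j) '' {j : Fin N | ∑ i, b i * F θ i j = Fbar F θ b})

/-- The set of beliefs `Ξ̂`: the union over tuples `𝐣` of the extreme points of `Ξ[𝐣]`. -/
def XiHat (F : Fin K → Fin M → Fin N → ℝ) : Set (Fin M → ℝ) :=
  ⋃ js : Fin K → Fin N, Set.extremePoints ℝ (XiT F js)

theorem Fbar_eq_of_mem_XiBR {F : Fin K → Fin M → Fin N → ℝ} {θ : Fin K} {j : Fin N}
    {b : Fin M → ℝ} (hb : b ∈ XiBR F θ j) : Fbar F θ b = ∑ i, b i * F θ i j :=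
  haveI : Nonempty (Fin N) := ⟨j⟩
  le_antisymm (ciSup_le hb.2)
    (le_ciSup (f := fun j => ∑ i, b i * F θ i j) (Set.finite_range _).bddAbove j)

theorem sum_mul_le_Vbar_of_mem_XiBR (L : Fin M → Fin N → ℝ) {F : Fin K → Fin M → Fin N → ℝ}
    {θ : Fin K} {j : Fin N} {b : Fin M → ℝ} (hb : b ∈ XiBR F θ j) :
    ∑ i, b i * L i j ≤ Vbar L F θ b :=
  le_csSup ((Set.toFinite _).image _).bddAbove
    (Set.mem_image_of_mem (fun j => ∑ i, b i * L i j) (Fbar_eq_of_mem_XiBR hb).symm)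

/-- refining a belief within the best-response region of a leader-favored best
response weakly increases the leader's value. -/
theorem leader_value_refinement_ge (M N K : ℕ) (hM : 0 < M) (hN : 0 < N) (hK : 0 < K)
    (L : Fin M → Fin N → ℝ) (F : Fin K → Fin M → Fin N → ℝ) (θ : Fin K)
    (b' : Fin M → ℝ) (hb' : b' ∈ stdSimplex ℝ (Fin M)) (jstar : Fin N)
    (hjF : ∑ i, b' i * F θ i jstar = Fbar F θ b')
    (hjL : ∑ i, b' i * L i jstar = Vbar L F θ b')
    (ω : (Fin M → ℝ) →₀ ℝ) (hω0 : ∀ b, 0 ≤ ω b)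
    (hsupp : (ω.support : Set (Fin M → ℝ)) ⊆ XiBR F θ jstar)
    (hmass : ∑ b ∈ ω.support, ω b = 1)
    (hbary : ∑ b ∈ ω.support, ω b • b = b') :
    ∑ b ∈ ω.support, ω b * Vbar L F θ b ≥ Vbar L F θ b' := by
  calc Vbar L F θ b' = ∑ i, b' i * L i jstar := hjL.symm
    _ = ∑ b ∈ ω.support, ω b * ∑ i, b i * L i jstar := by
      simp only [← hbary, Finset.sum_apply, Pi.smul_apply, smul_eq_mul, Finset.sum_mul,
        Finset.mul_sum, mul_assoc]
      exact Finset.sum_comm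
    _ ≤ ∑ b ∈ ω.support, ω b * Vbar L F θ b :=
      Finset.sum_le_sum fun b hb =>
        mul_le_mul_of_nonneg_left (sum_mul_le_Vbar_of_mem_XiBR L (hsupp hb)) (hω0 b)

end
end

section
/- For every map γ : Fin K → Fin K, the set P^γ := {π ∈ Π̂ | ∀ k : Fin K, ψ k π = γ k} of signalings in Π̂ under which every type k optimally reports γ k is a convex subset of the finite-dimensional space Fin K → (Ξ̂ → ℝ). -/
open Finset Set

attribute [local instance] Classical.propDecidable

noncomputable section

variable {M N K : ℕ}

/-- `Π̂` viewed as a subset of the finite-dimensional space `Fin K → (Ξ̂ → ℝ)`: tuples of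
probability weight vectors on the finite set `Ξ̂` satisfying the consistency equalities. -/
def PiHat (F : Fin K → Fin M → Fin N → ℝ) [Fintype (XiHat F)] :
    Set (Fin K → (XiHat F → ℝ)) :=
  {π | (∀ θ b, 0 ≤ π θ b) ∧ (∀ θ, ∑ b, π θ b = 1) ∧
    ∀ θ θ' : Fin K, ∀ i : Fin M,
      ∑ b, π θ b * (b : Fin M → ℝ) i = ∑ b, π θ' b * (b : Fin M → ℝ) i}

/-- The follower's expected utility `U π θ̂ θ` for signalings supported on `Ξ̂`. -/
def UsigHat (F : Fin K → Fin M → Fin N → ℝ) [Fintype (XiHat F)]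
    (π : Fin K → (XiHat F → ℝ)) (θhat θ : Fin K) : ℝ :=
  ∑ b, π θhat b * Fbar F θ (b : Fin M → ℝ)

/-- The leader's expected utility `V π θ̂ θ` for signalings supported on `Ξ̂`. -/
def VsigHat (L : Fin M → Fin N → ℝ) (F : Fin K → Fin M → Fin N → ℝ) [Fintype (XiHat F)]
    (π : Fin K → (XiHat F → ℝ)) (θhat θ : Fin K) : ℝ :=
  ∑ b, π θhat b * Vbar L F θ (b : Fin M → ℝ)

/-- The follower's optimal reporting strategy: the least maximizer of `UsigHat π · θ`. -/
def psiHat (F : Fin K → Fin M → Fin N → ℝ) [Fintype (XiHat F)]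
    (π : Fin K → (XiHat F → ℝ)) (θ : Fin K) : Fin K :=
  if h : (Finset.univ.filter fun θhat => ∀ β, UsigHat F π β θ ≤ UsigHat F π θhat θ).Nonempty then
    (Finset.univ.filter fun θhat => ∀ β, UsigHat F π β θ ≤ UsigHat F π θhat θ).min' h
  else θ

/-- The leader's expected utility `V^μ` under prior `μ`, on `Π̂`. -/
def VmuHat (L : Fin M → Fin N → ℝ) (F : Fin K → Fin M → Fin N → ℝ) [Fintype (XiHat F)]
    (μ : Fin K → ℝ) (π : Fin K → (XiHat F → ℝ)) : ℝ :=
  ∑ θ, μ θ * VsigHat L F π (psiHat F π θ) θ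

/-- The partition cell `P^γ`: signalings in `Π̂` under which every type `k` reports `γ k`. -/
def Pgamma (F : Fin K → Fin M → Fin N → ℝ) [Fintype (XiHat F)] (γ : Fin K → Fin K) :
    Set (Fin K → (XiHat F → ℝ)) :=
  {π | π ∈ PiHat F ∧ ∀ k : Fin K, psiHat F π k = γ k}

/-- `UsigHat` is linear in the signaling. -/
lemma UsigHat_combo (F : Fin K → Fin M → Fin N → ℝ) [Fintype (XiHat F)] (a c : ℝ)
    (π ρ : Fin K → (XiHat F → ℝ)) (β θ : Fin K) :
    UsigHat F (a • π + c • ρ) β θ = a * UsigHat F π β θ + c * UsigHat F ρ β θ := by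
  simp only [UsigHat, Pi.add_apply, Pi.smul_apply, smul_eq_mul, Finset.mul_sum,
    ← Finset.sum_add_distrib]
  exact Finset.sum_congr rfl fun b _ => by ring

/-- A report is the optimal one iff it is weakly better than every report and strictly better
than every smaller report. -/
lemma psiHat_eq_iff (F : Fin K → Fin M → Fin N → ℝ) [Fintype (XiHat F)]
    (π : Fin K → (XiHat F → ℝ)) (θ g : Fin K) :
    psiHat F π θ = g ↔ (∀ β, UsigHat F π β θ ≤ UsigHat F π g θ) ∧
      ∀ β < g, UsigHat F π β θ < UsigHat F π g θ := by
  have hne : (Finset.univ.filter fun θhat =>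
      ∀ β, UsigHat F π β θ ≤ UsigHat F π θhat θ).Nonempty := by
    obtain ⟨x, -, hx⟩ := Finset.exists_max_image (Finset.univ : Finset (Fin K))
      (fun β => UsigHat F π β θ) ⟨θ, Finset.mem_univ θ⟩
    exact ⟨x, by simpa using hx⟩
  rw [psiHat, dif_pos hne, Finset.min'_eq_iff]
  simp only [Finset.mem_filter, Finset.mem_univ, true_and]
  refine and_congr_right fun hg => ⟨fun h β hβ => ?_, fun h β hβ => ?_⟩
  · by_contra hlt
    exact absurd (h β fun β' => (hg β').trans (not_lt.mp hlt)) (not_le.mpr hβ)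
  · by_contra hlt
    exact absurd (hβ g) (not_le.mpr (h β (not_le.mp hlt)))

/-- The set `Π̂` is convex. -/
lemma convex_PiHat (F : Fin K → Fin M → Fin N → ℝ) [Fintype (XiHat F)] :
    Convex ℝ (PiHat F) := by
  rintro π ⟨hπ0, hπ1, hπc⟩ ρ ⟨hρ0, hρ1, hρc⟩ a c ha hc hac
  refine ⟨fun θ b => ?_, fun θ => ?_, fun θ θ' i => ?_⟩
  · exact add_nonneg (mul_nonneg ha (hπ0 θ b)) (mul_nonneg hc (hρ0 θ b))
  · simp only [Pi.add_apply, Pi.smul_apply, smul_eq_mul, Finset.sum_add_distrib,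
      ← Finset.mul_sum, hπ1, hρ1, mul_one, hac]
  · simp only [Pi.add_apply, Pi.smul_apply, smul_eq_mul, add_mul, mul_assoc,
      Finset.sum_add_distrib, ← Finset.mul_sum, hπc θ θ' i, hρc θ θ' i]

/-- each partition cell `P^γ` is a convex subset of the finite-dimensional
space `Fin K → (Ξ̂ → ℝ)`. -/
theorem Pgamma_convex (M N K : ℕ) (hM : 0 < M) (hN : 0 < N) (hK : 0 < K)
    (L : Fin M → Fin N → ℝ) (F : Fin K → Fin M → Fin N → ℝ) [Fintype (XiHat F)]
    (γ : Fin K → Fin K) :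
    Convex ℝ (Pgamma F γ) := by
  rintro π ⟨hπ, hπψ⟩ ρ ⟨hρ, hρψ⟩ a c ha hc hac
  refine ⟨convex_PiHat F hπ hρ ha hc hac, fun k => ?_⟩
  obtain ⟨hπle, hπlt⟩ := (psiHat_eq_iff F π k (γ k)).mp (hπψ k)
  obtain ⟨hρle, hρlt⟩ := (psiHat_eq_iff F ρ k (γ k)).mp (hρψ k)
  refine (psiHat_eq_iff F _ k (γ k)).mpr ⟨fun β => ?_, fun β hβ => ?_⟩
  · rw [UsigHat_combo, UsigHat_combo]
    exact add_le_add (mul_le_mul_of_nonneg_left (hπle β) ha)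
      (mul_le_mul_of_nonneg_left (hρle β) hc)
  · rw [UsigHat_combo, UsigHat_combo]
    rcases ha.eq_or_lt with rfl | ha'
    · obtain rfl : c = 1 := by linarith
      linarith [hρlt β hβ]
    · exact add_lt_add_of_lt_of_le (mul_lt_mul_of_pos_left (hπlt β hβ) ha')
        (mul_le_mul_of_nonneg_left (hρle β) hc)

end
end

section
/- Existence of approximate equilibria (Theorem 1): the set of achievable leader utilities V^μ '' Π̂ is nonempty and bounded — indeed |V^μ π| ≤ max_{i : Fin M, j : Fin N} |L i j| for every π ∈ Π̂ — hence s := sSup (V^μ '' Π̂) is a finite real number, and for every ε > 0 there exists π ∈ Π̂ with s - V^μ π < ε (an ε-sigBSE exists). -/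
open Finset Set

attribute [local instance] Classical.propDecidable

noncomputable section

variable {M N K : ℕ}

/-- A convex combination of reals bounded by `C` in absolute value is bounded by `C`. -/
theorem abs_sum_mul_le_of_weights {ι : Type*} [Fintype ι] {w x : ι → ℝ} {C : ℝ}
    (hw0 : ∀ i, 0 ≤ w i) (hw1 : ∑ i, w i = 1) (hx : ∀ i, |x i| ≤ C) :
    |∑ i, w i * x i| ≤ C :=
  calc |∑ i, w i * x i| ≤ ∑ i, |w i * x i| := Finset.abs_sum_le_sum_abs _ _
    _ ≤ ∑ i, w i * C := Finset.sum_le_sum fun i _ => by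
        rw [abs_mul, abs_of_nonneg (hw0 i)]
        exact mul_le_mul_of_nonneg_left (hx i) (hw0 i)
    _ = C := by rw [← Finset.sum_mul, hw1, one_mul]

theorem abs_le_iSup_iSup_abs (L : Fin M → Fin N → ℝ) (i : Fin M) (j : Fin N) :
    |L i j| ≤ ⨆ i : Fin M, ⨆ j : Fin N, |L i j| :=
  (le_ciSup (f := fun j => |L i j|) (Set.finite_range _).bddAbove j).trans
    (le_ciSup (f := fun i => ⨆ j : Fin N, |L i j|) (Set.finite_range _).bddAbove i)

theorem abs_Vbar_le (hN : 0 < N) (L : Fin M → Fin N → ℝ) (F : Fin K → Fin M → Fin N → ℝ)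
    (θ : Fin K) {b : Fin M → ℝ} (hb : b ∈ stdSimplex ℝ (Fin M)) :
    |Vbar L F θ b| ≤ ⨆ i : Fin M, ⨆ j : Fin N, |L i j| := by
  have : Nonempty (Fin N) := ⟨⟨0, hN⟩⟩
  obtain ⟨j₀, hj₀⟩ := exists_eq_ciSup_of_finite (f := fun j : Fin N => ∑ i, b i * F θ i j)
  have hne : ((fun j => ∑ i, b i * L i j) ''
      {j : Fin N | ∑ i, b i * F θ i j = Fbar F θ b}).Nonempty := ⟨_, j₀, hj₀, rfl⟩
  obtain ⟨j, -, hj⟩ := hne.csSup_mem (Set.toFinite _)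
  rw [Vbar, ← hj]
  exact abs_sum_mul_le_of_weights hb.1 hb.2 fun i => abs_le_iSup_iSup_abs L i j

theorem XiT_subset_stdSimplex (hK : 0 < K) (F : Fin K → Fin M → Fin N → ℝ)
    (js : Fin K → Fin N) : XiT F js ⊆ stdSimplex ℝ (Fin M) := fun _ hb =>
  (Set.mem_iInter.1 hb ⟨0, hK⟩).1

theorem XiHat_subset_stdSimplex (hK : 0 < K) (F : Fin K → Fin M → Fin N → ℝ) :
    XiHat F ⊆ stdSimplex ℝ (Fin M) :=
  Set.iUnion_subset fun js => extremePoints_subset.trans (XiT_subset_stdSimplex hK F js)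

theorem isCompact_XiT (hK : 0 < K) (F : Fin K → Fin M → Fin N → ℝ) (js : Fin K → Fin N) :
    IsCompact (XiT F js) := by
  refine (isCompact_stdSimplex ℝ (Fin M)).of_isClosed_subset ?_ (XiT_subset_stdSimplex hK F js)
  refine isClosed_iInter fun θ => ?_
  have h : XiBR F θ (js θ) = stdSimplex ℝ (Fin M) ∩
      ⋂ j', {b | ∑ i, b i * F θ i j' ≤ ∑ i, b i * F θ i (js θ)} := by
    ext b
    simp [XiBR]
  rw [h]
  exact (isClosed_stdSimplex ℝ (Fin M)).inter
    (isClosed_iInter fun j' => isClosed_le (by fun_prop) (by fun_prop))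

theorem XiHat_nonempty (hM : 0 < M) (hN : 0 < N) (hK : 0 < K)
    (F : Fin K → Fin M → Fin N → ℝ) : (XiHat F).Nonempty := by
  have : Nonempty (Fin N) := ⟨⟨0, hN⟩⟩
  have hb := single_mem_stdSimplex ℝ (⟨0, hM⟩ : Fin M)
  set b : Fin M → ℝ := Pi.single ⟨0, hM⟩ 1
  choose js hjs using fun θ => Finite.exists_max fun j : Fin N => ∑ i, b i * F θ i j
  have hne : (XiT F js).Nonempty := ⟨b, Set.mem_iInter.2 fun θ => ⟨hb, hjs θ⟩⟩
  obtain ⟨e, he⟩ := (isCompact_XiT hK F js).extremePoints_nonempty hne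
  exact ⟨e, Set.mem_iUnion.2 ⟨js, he⟩⟩

theorem PiHat_nonempty (hM : 0 < M) (hN : 0 < N) (hK : 0 < K)
    (F : Fin K → Fin M → Fin N → ℝ) [Fintype (XiHat F)] : (PiHat F).Nonempty := by
  obtain ⟨e, he⟩ := XiHat_nonempty hM hN hK F
  have h := single_mem_stdSimplex ℝ (⟨e, he⟩ : XiHat F)
  exact ⟨fun _ => Pi.single ⟨e, he⟩ 1, fun _ => h.1, fun _ => h.2, fun _ _ _ => rfl⟩

theorem abs_VmuHat_le (hN : 0 < N) (hK : 0 < K) (L : Fin M → Fin N → ℝ)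
    (F : Fin K → Fin M → Fin N → ℝ) [Fintype (XiHat F)] {μ : Fin K → ℝ}
    (hμ0 : ∀ θ, 0 ≤ μ θ) (hμ1 : ∑ θ, μ θ = 1) {π : Fin K → (XiHat F → ℝ)}
    (hπ : π ∈ PiHat F) : |VmuHat L F μ π| ≤ ⨆ i : Fin M, ⨆ j : Fin N, |L i j| :=
  abs_sum_mul_le_of_weights hμ0 hμ1 fun θ =>
    abs_sum_mul_le_of_weights (hπ.1 _) (hπ.2.1 _) fun b =>
      abs_Vbar_le hN L F θ (XiHat_subset_stdSimplex hK F b.2)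

/-- Theorem 1: the set of achievable leader utilities is nonempty and bounded
by `max_{i,j} |L i j|`, so its supremum is finite, and `ε`-sigBSEs exist for every `ε > 0`. -/
theorem eps_sigBSE_exists (M N K : ℕ) (hM : 0 < M) (hN : 0 < N) (hK : 0 < K)
    (L : Fin M → Fin N → ℝ) (F : Fin K → Fin M → Fin N → ℝ) [Fintype (XiHat F)]
    (μ : Fin K → ℝ) (hμ0 : ∀ θ, 0 ≤ μ θ) (hμ1 : ∑ θ, μ θ = 1) :
    (VmuHat L F μ '' PiHat F).Nonempty ∧
      (∀ π ∈ PiHat F, |VmuHat L F μ π| ≤ ⨆ i : Fin M, ⨆ j : Fin N, |L i j|) ∧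
      ∀ ε > (0 : ℝ), ∃ π ∈ PiHat F,
        sSup (VmuHat L F μ '' PiHat F) - VmuHat L F μ π < ε := by
  have hne : (VmuHat L F μ '' PiHat F).Nonempty := (PiHat_nonempty hM hN hK F).image _
  refine ⟨hne, fun π hπ => abs_VmuHat_le hN hK L F hμ0 hμ1 hπ, fun ε hε => ?_⟩
  obtain ⟨_, ⟨π, hπ, rfl⟩, hlt⟩ := exists_lt_of_lt_csSup hne (sub_lt_self _ hε)
  exact ⟨π, hπ, by linarith⟩

end
end
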